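/- Let M ⊆ ℝⁿ be a cube-like n-polytope, let x ∈ M, and let i := ind_M(x). Then there exist a relatively open subset U of M with x ∈ U and a bijection κ : U → [0,1)^i × (−1,1)^{n−i} ⊆ ℝⁿ such that κ is smooth on U (ContDiffOn ℝ ⊤ as a map into ℝⁿ), κ⁻¹ is smooth on [0,1)^i × (−1,1)^{n−i}, κ(x) = 0, and U ∩ F = ∅ for every facet F of M with x ∉ F (i.e., M admits a standard chart around every point). -/

import Mathlib

open Set

variable {E : Type*} [AddCommGroup E] [Module ℝ E]

/-- A polytope is the convex hull of a nonempty finite set. -/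
def IsPolytope (M : Set E) : Prop :=
  ∃ S : Set E, S.Finite ∧ S.Nonempty ∧ M = convexHull ℝ S

/-- The dimension of a set: the dimension of its affine span. -/
noncomputable def polyDim (A : Set E) : ℕ :=
  Module.finrank ℝ (affineSpan ℝ A).direction

/-- A face of `M` is a nonempty extreme subset of `M`. -/
def IsFace (M F : Set E) : Prop := F.Nonempty ∧ IsExtreme ℝ M F

/-- A vertex of `M` is a point whose singleton is a face of `M`. -/
def IsVertex (M : Set E) (x : E) : Prop := IsFace M {x}

/-- An edge of `M` is a one-dimensional face of `M`. -/
def IsEdge (M F : Set E) : Prop := IsFace M F ∧ polyDim F = 1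

/-- A polytope is simple if every vertex is contained in exactly `dim M` edges. -/
def IsSimplePolytope (M : Set E) : Prop :=
  IsPolytope M ∧
    ∀ x, IsVertex M x → {F : Set E | IsEdge M F ∧ x ∈ F}.ncard = polyDim M

/-- The smallest face of `M` containing `x`: the intersection of all faces containing `x`. -/
def smallestFace (M : Set E) (x : E) : Set E :=
  ⋂₀ {F : Set E | IsFace M F ∧ x ∈ F}

/-- `Edir M x` is the direction of the affine span of the smallest face of `M`
containing `x`. -/
noncomputable def Edir (M : Set E) (x : E) : Submodule ℝ E :=
  (affineSpan ℝ (smallestFace M x)).direction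

/-- An `n`-polytope `M ⊆ ℝⁿ` is cube-like if every point of `M` has a relatively open
neighborhood `U` in `M` admitting a bijection `φ` onto a relatively open subset `V` of
`[0,∞)ⁿ` such that `φ` is smooth on `U` and its inverse is smooth on `V`. -/
def CubeLike {n : ℕ} (M : Set (Fin n → ℝ)) : Prop :=
  ∀ x ∈ M, ∃ U V : Set (Fin n → ℝ), x ∈ U ∧
    (∃ U₀, IsOpen U₀ ∧ U = M ∩ U₀) ∧
    (∃ V₀, IsOpen V₀ ∧ V = {y : Fin n → ℝ | ∀ l, 0 ≤ y l} ∩ V₀) ∧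
    ∃ φ ψ : (Fin n → ℝ) → (Fin n → ℝ),
      Set.BijOn φ U V ∧ Set.InvOn ψ φ U V ∧
      ContDiffOn ℝ (⊤ : ℕ∞) φ U ∧ ContDiffOn ℝ (⊤ : ℕ∞) ψ V

/-- `Tset n i` is the model corner `[0,1)^i × (−1,1)^{n−i} ⊆ ℝⁿ`, identifying `ℝⁿ`
with `ℝ^i × ℝ^{n−i}`. -/
def Tset (n i : ℕ) : Set (Fin n → ℝ) :=
  {y | ∀ l : Fin n, ((l : ℕ) < i → y l ∈ Set.Ico (0 : ℝ) 1) ∧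
        (i ≤ (l : ℕ) → y l ∈ Set.Ioo (-1 : ℝ) 1)}

open Filter Topology

/-- Bounded nonnegative representations in a finitely generated cone. -/
lemma cone_bound {ι F : Type*} [NormedAddCommGroup F] [NormedSpace ℝ F] (u : ι → F)
    (T : Finset ι) : ∃ K : ℝ, 0 ≤ K ∧ ∀ a : ι → ℝ, (∀ i ∈ T, 0 ≤ a i) →
      ∃ b : ι → ℝ, (∀ i ∈ T, 0 ≤ b i) ∧ ∑ i ∈ T, b i • u i = ∑ i ∈ T, a i • u i ∧
        ∑ i ∈ T, b i ≤ K * ‖∑ i ∈ T, a i • u i‖ := by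
  classical
  induction T using Finset.strongInduction with
  | H T ih =>
  by_cases h : ∀ c : ι → ℝ, ∑ i ∈ T, c i • u i = 0 → ∀ i ∈ T, c i = 0
  · let f : (T → ℝ) →ₗ[ℝ] F := Fintype.linearCombination ℝ (fun i : T => u i)
    have hf : ∀ c : ι → ℝ, f (fun i => c i) = ∑ i ∈ T, c i • u i := by
      intro c
      simp only [f, Fintype.linearCombination_apply]
      exact Finset.sum_coe_sort T (fun i => c i • u i)
    have hker : LinearMap.ker f = ⊥ := by
      rw [LinearMap.ker_eq_bot']
      intro m hm
      let c : ι → ℝ := fun i => if hi : i ∈ T then m ⟨i, hi⟩ else 0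
      have hc : (fun i : T => c i) = m := by
        funext i; simp [c]
      have := h c (by rw [← hf, hc, hm])
      funext i
      have h2 := this i i.2
      simpa [c] using h2
    obtain ⟨K, _, hK⟩ := f.exists_antilipschitzWith hker
    refine ⟨T.card * K, by positivity, fun a ha => ⟨a, ha, rfl, ?_⟩⟩
    have h1 : ‖(fun i : T => a i)‖ ≤ K * ‖∑ i ∈ T, a i • u i‖ := by
      rw [← hf]
      have := hK.le_mul_dist (fun i : T => a i) 0
      simpa using this
    calc ∑ i ∈ T, a i ≤ ∑ i ∈ T, K * ‖∑ i ∈ T, a i • u i‖ := by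
          refine Finset.sum_le_sum fun i hi => ?_
          refine le_trans ?_ h1
          refine le_trans (le_abs_self _) ?_
          exact norm_le_pi_norm (fun i : T => a i) ⟨i, hi⟩
      _ = _ := by simp [mul_assoc]
  · push Not at h
    obtain ⟨c₀, hc₀, i₀, hi₀, hci₀⟩ := h
    obtain ⟨c, hc, hcpos⟩ : ∃ c : ι → ℝ, ∑ i ∈ T, c i • u i = 0 ∧ ∃ i ∈ T, 0 < c i := by
      rcases lt_or_gt_of_ne hci₀ with h | h
      · refine ⟨fun i => - c₀ i, by simp [hc₀], i₀, hi₀, by simpa using h⟩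
      · exact ⟨c₀, hc₀, i₀, hi₀, h⟩
    have ih' : ∀ j : ι, ∃ K : ℝ, 0 ≤ K ∧ (j ∈ T → ∀ a : ι → ℝ, (∀ i ∈ T.erase j, 0 ≤ a i) →
      ∃ b : ι → ℝ, (∀ i ∈ T.erase j, 0 ≤ b i) ∧
        ∑ i ∈ T.erase j, b i • u i = ∑ i ∈ T.erase j, a i • u i ∧
        ∑ i ∈ T.erase j, b i ≤ K * ‖∑ i ∈ T.erase j, a i • u i‖) := by
      intro j
      by_cases hj : j ∈ T
      · obtain ⟨K, hK, h⟩ := ih (T.erase j) (Finset.erase_ssubset hj)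
        exact ⟨K, hK, fun _ => h⟩
      · exact ⟨0, le_rfl, fun h => absurd h hj⟩
    choose K hK0 hK using ih'
    refine ⟨∑ j ∈ T, K j, Finset.sum_nonneg fun j _ => hK0 j, fun a ha => ?_⟩
    obtain ⟨j, hj, hjmin⟩ := Finset.exists_min_image (T.filter fun i => 0 < c i)
      (fun i => a i / c i) (by obtain ⟨i, hi, hi'⟩ := hcpos; exact ⟨i, by simp [hi, hi']⟩)
    rw [Finset.mem_filter] at hj
    obtain ⟨hjT, hcj⟩ := hj
    set r := a j / c j with hr
    have hr0 : 0 ≤ r := div_nonneg (ha j hjT) hcj.le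
    let a' : ι → ℝ := fun i => a i - r * c i
    have ha'j : a' j = 0 := by simp only [a', hr]; field_simp; simp
    have ha'0 : ∀ i ∈ T, 0 ≤ a' i := by
      intro i hi
      simp only [a']
      rcases le_or_gt (c i) 0 with h | h
      · nlinarith [ha i hi]
      · have := hjmin i (by simp [hi, h])
        rw [le_div_iff₀ h] at this
        linarith
    have hsum : ∑ i ∈ T, a' i • u i = ∑ i ∈ T, a i • u i := by
      simp only [a', sub_smul, mul_smul, Finset.sum_sub_distrib, ← Finset.smul_sum, hc]
      simp
    have hsum' : ∑ i ∈ T.erase j, a' i • u i = ∑ i ∈ T, a i • u i := by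
      rw [← hsum, ← Finset.add_sum_erase T _ hjT, ha'j]; simp
    obtain ⟨b, hb0, hb1, hb2⟩ := hK j hjT a' (fun i hi => ha'0 i (Finset.mem_of_mem_erase hi))
    rw [hsum'] at hb1 hb2
    have hbe : ∀ i ∈ T.erase j, (if i = j then 0 else b i) = b i := by
      intro i hi; rw [if_neg (Finset.ne_of_mem_erase hi)]
    refine ⟨fun i => if i = j then 0 else b i, ?_, ?_, ?_⟩
    · intro i hi
      by_cases hij : i = j
      · simp [hij]
      · simpa [hij] using hb0 i (Finset.mem_erase.2 ⟨hij, hi⟩)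
    · rw [← Finset.add_sum_erase T _ hjT, ← hb1]
      simp only [if_true, zero_smul, zero_add]
      exact Finset.sum_congr rfl fun i hi => by rw [hbe i hi]
    · rw [← Finset.add_sum_erase T _ hjT]
      simp only [if_true, zero_add]
      rw [Finset.sum_congr rfl hbe]
      refine hb2.trans ?_
      gcongr
      exact Finset.single_le_sum (f := K) (fun j _ => hK0 j) hjT

/-- A polytope is locally conical. -/
lemma polytope_conical {F : Type*} [NormedAddCommGroup F] [NormedSpace ℝ F] {M : Set F}
    (hM : IsPolytope M) {x : F} (hx : x ∈ M) :
    ∃ ε : ℝ, 0 < ε ∧ ∀ (v : F) (t : ℝ), 0 < t → x + t • v ∈ M → ‖v‖ < ε → x + v ∈ M := by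
  classical
  obtain ⟨S, hS, -, rfl⟩ := hM
  lift S to Finset F using hS
  obtain ⟨K, hK0, hK⟩ := cone_bound (fun s : F => s - x) S
  refine ⟨1 / (K + 1), by positivity, fun v t ht hv hvε => ?_⟩
  obtain ⟨w, hw0, hw1, hw2⟩ := Finset.mem_convexHull'.1 hv
  have key : ∑ s ∈ S, (t⁻¹ * w s) • (s - x) = v := by
    simp only [mul_smul, ← Finset.smul_sum, smul_sub, Finset.sum_sub_distrib]
    rw [hw2, ← smul_sub, ← Finset.sum_smul, hw1]
    simp [ht.ne']
  obtain ⟨b, hb0, hb1, hb2⟩ := hK (fun s => t⁻¹ * w s)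
    (fun s hs => mul_nonneg (inv_nonneg.2 ht.le) (hw0 s hs))
  rw [key] at hb1 hb2
  have hle : ∑ s ∈ S, b s ≤ 1 := by
    refine hb2.trans ?_
    rw [lt_div_iff₀ (by positivity)] at hvε
    nlinarith [norm_nonneg v]
  have hc : Convex ℝ (convexHull ℝ (S : Set F)) := convex_convexHull _ _
  let z : Option F → F := fun o => o.elim x id
  let g : Option F → ℝ := fun o => o.elim (1 - ∑ s ∈ S, b s) b
  have := hc.sum_mem (t := Finset.insertNone S) (w := g) (z := z) ?_ ?_ ?_
  · convert this using 1
    rw [Finset.sum_insertNone]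
    simp only [g, z, Option.elim, id]
    rw [← hb1]
    simp only [smul_sub, Finset.sum_sub_distrib, sub_smul, ← Finset.sum_smul]
    simp
    abel
  · intro o ho
    cases o with
    | none => simpa [g] using hle
    | some s => exact hb0 s (by simpa using ho)
  · rw [Finset.sum_insertNone]; simp [g]
  · intro o ho
    cases o with
    | none => exact hx
    | some s => exact subset_convexHull _ _ (by simpa [z] using ho)

/-- One-sided directional derivatives. -/
lemma dir_lim {F G : Type*} [NormedAddCommGroup F] [NormedSpace ℝ F] [NormedAddCommGroup G]
    [NormedSpace ℝ G] {f : F → G} {A : F →L[ℝ] G} {S : Set F} {p v : F}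
    (h : HasFDerivWithinAt f A S p) (hv : ∀ᶠ s : ℝ in 𝓝[>] 0, p + s • v ∈ S) :
    Tendsto (fun s : ℝ => s⁻¹ • (f (p + s • v) - f p)) (𝓝[>] 0) (𝓝 (A v)) := by
  refine h.lim ?_ hv ?_
  · have : Tendsto (fun s : ℝ => s • v) (𝓝 0) (𝓝 ((0 : ℝ) • v)) :=
      (continuous_id.smul continuous_const).tendsto 0
    rw [zero_smul] at this
    exact this.mono_left nhdsWithin_le_nhds
  · refine tendsto_const_nhds.congr' ?_
    filter_upwards [self_mem_nhdsWithin] with s hs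
    rw [smul_smul, inv_mul_cancel₀ (ne_of_gt hs), one_smul]

/-- If a curve in the polytope leaves `x` with velocity `v`, then `v` is a feasible direction. -/
lemma feasible_of_curve {F : Type*} [NormedAddCommGroup F] [NormedSpace ℝ F] {M : Set F}
    (hM : IsPolytope M) {x : F} (hx : x ∈ M) {γ : ℝ → F} {v : F}
    (hγ : ∀ᶠ s : ℝ in 𝓝[>] 0, γ s ∈ M)
    (hl : Tendsto (fun s : ℝ => s⁻¹ • (γ s - x)) (𝓝[>] 0) (𝓝 v)) :
    ∃ t : ℝ, 0 < t ∧ ∀ r ∈ Set.Ioc 0 t, x + r • v ∈ M := by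
  obtain ⟨ε, hε, hcon⟩ := polytope_conical hM hx
  have hcl : IsClosed M := by
    obtain ⟨S, hS, -, rfl⟩ := hM
    exact hS.isClosed_convexHull ℝ
  refine ⟨ε / (‖v‖ + 1), by positivity, fun r hr => ?_⟩
  have hrv : ‖r • v‖ < ε := by
    rw [norm_smul, Real.norm_of_nonneg hr.1.le]
    have := hr.2
    rw [le_div_iff₀ (by positivity)] at this
    nlinarith [hr.1, norm_nonneg v]
  have hl' : Tendsto (fun s : ℝ => r • s⁻¹ • (γ s - x)) (𝓝[>] 0) (𝓝 (r • v)) := hl.const_smul r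
  refine hcl.mem_of_tendsto (tendsto_const_nhds.add hl') ?_
  filter_upwards [hγ, self_mem_nhdsWithin, hl'.norm.eventually (gt_mem_nhds hrv)] with s hs hs0 hn
  have hs0' : (0 : ℝ) < s := hs0
  refine hcon _ (s / r) (div_pos hs0' hr.1) ?_ hn
  have : (s / r) • r • s⁻¹ • (γ s - x) = γ s - x := by
    rw [smul_smul, smul_smul]
    have : s / r * r * s⁻¹ = 1 := by have := hr.1.ne'; field_simp
    rw [this, one_smul]
  rw [this]; simpa using hs

lemma smallestFace_subset_feasible {M : Set E} (hM : Convex ℝ M) {x p : E}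
    (hx : x ∈ M) (hp : p ∈ smallestFace M x) :
    p ∈ M ∧ ∃ t : ℝ, 0 < t ∧ x - t • (p - x) ∈ M := by
  let G : Set E := {p | p ∈ M ∧ ∃ t : ℝ, 0 < t ∧ x - t • (p - x) ∈ M}
  have hxG : x ∈ G := ⟨hx, 1, one_pos, by simpa using hx⟩
  have : IsFace M G := by
    refine ⟨⟨x, hxG⟩, fun p hp => hp.1, ?_⟩
    rintro p₁ h₁ p₂ h₂ q ⟨hq, t, ht, hqt⟩ ⟨a, b, ha, hb, hab, rfl⟩
    refine ⟨h₁, t * a / (1 + t * b), by positivity, ?_⟩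
    have h0 : (0 : ℝ) < 1 + t * b := by positivity
    have := hM hqt h₂ (a := 1 / (1 + t * b)) (b := t * b / (1 + t * b)) (by positivity)
      (by positivity) (by field_simp)
    convert this using 1
    have hb' : b = 1 - a := by linarith
    subst hb'
    have hne : (1 + t * (1 - a)) ≠ 0 := h0.ne'
    match_scalars <;> field_simp <;> ring
  exact hp G ⟨this, hxG⟩

lemma mem_smallestFace_of_feasible {M : Set E} {x v : E}
    {t : ℝ} (h₁ : x + t • v ∈ M) (h₂ : x - t • v ∈ M) :
    x + t • v ∈ smallestFace M x := by
  rintro F ⟨hF, hxF⟩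
  refine hF.2.left_mem_of_mem_openSegment h₁ h₂ hxF ⟨1/2, 1/2, by norm_num, by norm_num,
    by norm_num, ?_⟩
  module

lemma finrank_coord {n : ℕ} (Z : Finset (Fin n)) (W : Submodule ℝ (Fin n → ℝ))
    (hW : ∀ w, w ∈ W ↔ ∀ l ∈ Z, w l = 0) : Module.finrank ℝ W = n - Z.card := by
  classical
  have h : W = ⨅ i ∈ (Z : Set (Fin n)),
      LinearMap.ker (LinearMap.proj i : (Fin n → ℝ) →ₗ[ℝ] ℝ) := by
    ext w; simp [hW, Submodule.mem_iInf]
  rw [h, (LinearMap.iInfKerProjEquiv ℝ (fun _ : Fin n => ℝ) (I := (Z : Set (Fin n))ᶜ)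
    (J := (Z : Set (Fin n))) disjoint_compl_left (by simp)).finrank_eq]
  have h2 := Finset.card_compl Z
  rw [Fintype.card_fin] at h2
  rw [← h2]
  simp only [Module.finrank_fintype_fun_eq_card]
  rw [Fintype.card_subtype]
  congr 1
  ext l
  simp

lemma exists_perm {n : ℕ} (Z : Finset (Fin n)) :
    ∃ e : Equiv.Perm (Fin n), ∀ l : Fin n, (l : ℕ) < Z.card ↔ e l ∈ Z := by
  classical
  have hcard : Fintype.card {l : Fin n // (l : ℕ) < Z.card} = Fintype.card {l : Fin n // l ∈ Z} := by
    have : Z.card ≤ n := by simpa using Z.card_le_univ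
    rw [Fintype.card_subtype, Fin.card_filter_val_lt]
    simp [this]
  let e := (Fintype.equivOfCardEq hcard).extendSubtype
  refine ⟨e, fun l => ⟨fun h => ?_, fun h => ?_⟩⟩
  · exact (Fintype.equivOfCardEq hcard).extendSubtype_mem l h
  · by_contra h'
    exact (Fintype.equivOfCardEq hcard).extendSubtype_not_mem l h' h

lemma eventually_add_smul_mem {F : Type*} [NormedAddCommGroup F] [NormedSpace ℝ F] {O : Set F}
    (hO : IsOpen O) {p : F} (hp : p ∈ O) (v : F) : ∀ᶠ s : ℝ in 𝓝[>] 0, p + s • v ∈ O := by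
  have h : Tendsto (fun s : ℝ => p + s • v) (𝓝 0) (𝓝 (p + (0 : ℝ) • v)) :=
    (continuous_const.add (continuous_id.smul continuous_const)).tendsto 0
  rw [zero_smul, add_zero] at h
  exact (h.mono_left nhdsWithin_le_nhds).eventually (hO.mem_nhds hp)

lemma eventually_feasible {M : Set E} (hM : Convex ℝ M) {x v : E} (hx : x ∈ M) {t : ℝ}
    (ht : 0 < t) (h : x + t • v ∈ M) : ∀ᶠ s : ℝ in 𝓝[>] 0, x + s • v ∈ M := by
  filter_upwards [Ioo_mem_nhdsGT ht] with s hs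
  have := hM hx h (a := 1 - s / t) (b := s / t)
    (by rw [sub_nonneg, div_le_one ht]; exact hs.2.le) (div_nonneg hs.1.le ht.le) (by ring)
  convert this using 1
  match_scalars <;> field_simp <;> ring

/-- The dimension count: the index of `x` is the number of vanishing chart coordinates. -/
lemma index_eq {n : ℕ} {M U V U₀ V₀ : Set (Fin n → ℝ)}
    (hM : IsPolytope M) (hMint : (interior M).Nonempty) {x : Fin n → ℝ} (hxU : x ∈ U)
    (hU₀ : IsOpen U₀) (hU : U = M ∩ U₀)
    (hV₀ : IsOpen V₀) (hV : V = {y : Fin n → ℝ | ∀ l, 0 ≤ y l} ∩ V₀)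
    {φ ψ : (Fin n → ℝ) → (Fin n → ℝ)} (hbij : Set.BijOn φ U V) (hinv : Set.InvOn ψ φ U V)
    (hφ : ContDiffOn ℝ (⊤ : ℕ∞) φ U) (hψ : ContDiffOn ℝ (⊤ : ℕ∞) ψ V)
    (Z : Finset (Fin n)) (hZ : ∀ l, l ∈ Z ↔ φ x l = 0) :
    n - polyDim (smallestFace M x) = Z.card := by
  have hMc : Convex ℝ M := by
    obtain ⟨S, -, -, rfl⟩ := hM
    exact convex_convexHull _ _
  have hx : x ∈ M := by rw [hU] at hxU; exact hxU.1
  have hxU₀ : x ∈ U₀ := by rw [hU] at hxU; exact hxU.2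
  have hyV : φ x ∈ V := hbij.mapsTo hxU
  have hψx : ψ (φ x) = x := hinv.1 hxU
  have hψmaps : Set.MapsTo ψ V U := hbij.symm hinv.symm |>.mapsTo
  have hyV' := hyV
  rw [hV] at hyV'
  have hpos : ∀ l, 0 ≤ φ x l := hyV'.1
  have udU : UniqueDiffOn ℝ U := by
    rw [hU]; exact (uniqueDiffOn_convex hMc hMint).inter hU₀
  have udV : UniqueDiffOn ℝ V := by
    rw [hV]
    refine UniqueDiffOn.inter (uniqueDiffOn_convex ?_ ?_) hV₀
    · intro a ha b hb s t hs ht _ l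
      have := ha l
      have := hb l
      simp only [Pi.add_apply, Pi.smul_apply, smul_eq_mul]
      positivity
    · refine ⟨fun _ => 1, ?_⟩
      rw [mem_interior]
      refine ⟨Set.pi Set.univ fun _ => Set.Ioi 0, ?_, isOpen_set_pi Set.finite_univ
        fun _ _ => isOpen_Ioi, ?_⟩
      · intro a ha l
        exact le_of_lt (ha l (Set.mem_univ l))
      · intro l _; simp
  set A := fderivWithin ℝ φ U x with hA
  set B := fderivWithin ℝ ψ V (φ x) with hB
  have hdA : HasFDerivWithinAt φ A U x :=
    ((hφ.differentiableOn (by simp)) x hxU).hasFDerivWithinAt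
  have hdB : HasFDerivWithinAt ψ B V (φ x) :=
    ((hψ.differentiableOn (by simp)) _ hyV).hasFDerivWithinAt
  have hBA : B.comp A = ContinuousLinearMap.id ℝ _ := by
    refine (udU x hxU).eq (hdB.comp x hdA hbij.mapsTo) ?_
    refine (hasFDerivWithinAt_id x U).congr (fun p hp => hinv.1 hp) (hinv.1 hxU)
  have hAB : A.comp B = ContinuousLinearMap.id ℝ _ := by
    have hdA' : HasFDerivWithinAt φ A U (ψ (φ x)) := by rw [hψx]; exact hdA
    refine (udV _ hyV).eq (hdA'.comp _ hdB hψmaps) ?_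
    refine (hasFDerivWithinAt_id _ V).congr (fun p hp => hinv.2 hp) (hinv.2 hyV)
  -- feasible directions have nonnegative image
  have hnn : ∀ (v : Fin n → ℝ) (t : ℝ), 0 < t → x + t • v ∈ M → ∀ l ∈ Z, 0 ≤ A v l := by
    intro v t ht htv l hl
    have hev : ∀ᶠ s : ℝ in 𝓝[>] 0, x + s • v ∈ U := by
      filter_upwards [eventually_feasible hMc hx ht htv, eventually_add_smul_mem hU₀ hxU₀ v]
        with s h1 h2
      rw [hU]; exact ⟨h1, h2⟩
    have hlim := (tendsto_pi_nhds.1 (dir_lim hdA hev)) l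
    refine ge_of_tendsto hlim ?_
    filter_upwards [hev, self_mem_nhdsWithin] with s hs hs0
    have hs0' : (0 : ℝ) < s := hs0
    have h3 := hbij.mapsTo hs
    rw [hV] at h3
    have h4 := h3.1 l
    simp only [Pi.smul_apply, Pi.sub_apply, (hZ l).1 hl, smul_eq_mul, sub_zero]
    positivity
  -- directions in the coordinate subspace are feasible
  have hfe : ∀ w : Fin n → ℝ, (∀ l ∈ Z, w l = 0) →
      ∃ t : ℝ, 0 < t ∧ ∀ r ∈ Set.Ioc 0 t, x + r • B w ∈ M := by
    intro w hw
    have hev : ∀ᶠ s : ℝ in 𝓝[>] 0, φ x + s • w ∈ V := by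
      have h1 : ∀ l, ∀ᶠ s : ℝ in 𝓝[>] 0, 0 ≤ (φ x + s • w) l := by
        intro l
        by_cases hl : l ∈ Z
        · filter_upwards with s
          simp [hw l hl, (hZ l).1 hl]
        · have : 0 < φ x l := lt_of_le_of_ne (hpos l) (fun h => hl ((hZ l).2 h.symm))
          filter_upwards [eventually_add_smul_mem (isOpen_Ioi (a := (0 : ℝ))) this (w l)] with s hs
          exact le_of_lt hs
      filter_upwards [eventually_all.2 h1, eventually_add_smul_mem hV₀ hyV'.2 w] with s h1 h2
      rw [hV]; exact ⟨h1, h2⟩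
    have hlim := dir_lim hdB hev
    rw [hψx] at hlim
    refine feasible_of_curve hM hx (γ := fun s => ψ (φ x + s • w)) ?_ hlim
    filter_upwards [hev] with s hs
    have := hψmaps hs
    rw [hU] at this
    exact this.1
  have hxF : x ∈ smallestFace M x := fun F hF => hF.2
  let W : Submodule ℝ (Fin n → ℝ) :=
    { carrier := {w | ∀ l ∈ Z, w l = 0}
      add_mem' := by
        intro a b ha hb l hl
        simp [ha l hl, hb l hl]
      zero_mem' := by intro l _; rfl
      smul_mem' := by
        intro c a ha l hl
        simp [ha l hl] }
  have hWmem : ∀ w, w ∈ W ↔ ∀ l ∈ Z, w l = 0 := fun w => Iff.rfl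
  let eA : (Fin n → ℝ) ≃ₗ[ℝ] (Fin n → ℝ) :=
    LinearEquiv.ofLinearMap (A : (Fin n → ℝ) →ₗ[ℝ] (Fin n → ℝ)) (B : (Fin n → ℝ) →ₗ[ℝ] (Fin n → ℝ))
      (LinearMap.ext fun v => DFunLike.congr_fun hAB v)
      (LinearMap.ext fun v => DFunLike.congr_fun hBA v)
  have hABv : ∀ w, A (B w) = w := fun w => DFunLike.congr_fun hAB w
  have hmap : (affineSpan ℝ (smallestFace M x)).direction.map
      (eA : (Fin n → ℝ) →ₗ[ℝ] (Fin n → ℝ)) = W := by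
    apply le_antisymm
    · rw [direction_affineSpan, vectorSpan_eq_span_vsub_set_right ℝ hxF, Submodule.map_span_le]
      rintro _ ⟨p, hp, rfl⟩
      rw [hWmem]
      intro l hl
      obtain ⟨hpM, t, ht, hpt⟩ := smallestFace_subset_feasible hMc hx hp
      have h1 := hnn (p - x) 1 one_pos (by simpa using hpM) l hl
      have h2 := hnn (-(p - x)) t ht (by rw [smul_neg, ← sub_eq_add_neg]; exact hpt) l hl
      rw [map_neg, Pi.neg_apply] at h2
      change A (p - x) l = 0
      exact le_antisymm (by linarith) h1
    · intro w hw
      refine ⟨B w, ?_, hABv w⟩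
      obtain ⟨t₁, ht₁, h₁⟩ := hfe w hw
      obtain ⟨t₂, ht₂, h₂⟩ := hfe (-w) (W.neg_mem hw)
      set r := min t₁ t₂ with hr
      have hr0 : 0 < r := lt_min ht₁ ht₂
      have h3 := h₁ r ⟨hr0, min_le_left _ _⟩
      have h4 := h₂ r ⟨hr0, min_le_right _ _⟩
      rw [map_neg, smul_neg, ← sub_eq_add_neg] at h4
      have h5 := mem_smallestFace_of_feasible h3 h4
      have h6 := vsub_mem_vectorSpan ℝ h5 hxF
      rw [← direction_affineSpan] at h6
      have h7 := Submodule.smul_mem _ r⁻¹ h6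
      have h8 : r⁻¹ • ((x + r • B w) -ᵥ x) = B w := by
        simp [vsub_eq_sub, smul_smul, hr0.ne']
      rwa [h8] at h7
  have hfin := finrank_coord Z W hWmem
  rw [← hmap, LinearEquiv.finrank_map_eq] at hfin
  have hcard : Z.card ≤ n := by simpa using Z.card_le_univ
  unfold polyDim
  omega

/-- **Existence of standard charts** (Lemma 4.6).  Let `M ⊆ ℝⁿ` be a cube-like
`n`-polytope, `x ∈ M`, and `i := ind_M(x) = n − dim M(x)`.  Then there is a relatively
open neighborhood `U` of `x` in `M` and a `C^∞`-diffeomorphism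
`κ : U → [0,1)^i × (−1,1)^{n−i}` with `κ x = 0` and `U ∩ F = ∅` for every facet `F`
of `M` with `x ∉ F`. -/
theorem exists_standard_chart {n : ℕ} {M : Set (Fin n → ℝ)}
    (hM : IsPolytope M) (hMint : (interior M).Nonempty) (hcl : CubeLike M)
    {x : Fin n → ℝ} (hx : x ∈ M) :
    ∃ U : Set (Fin n → ℝ), ∃ κ ψ : (Fin n → ℝ) → (Fin n → ℝ),
      x ∈ U ∧ (∃ U₀, IsOpen U₀ ∧ U = M ∩ U₀) ∧
      Set.BijOn κ U (Tset n (n - polyDim (smallestFace M x))) ∧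
      Set.InvOn ψ κ U (Tset n (n - polyDim (smallestFace M x))) ∧
      ContDiffOn ℝ (⊤ : ℕ∞) κ U ∧
      ContDiffOn ℝ (⊤ : ℕ∞) ψ (Tset n (n - polyDim (smallestFace M x))) ∧
      κ x = 0 ∧
      ∀ F : Set (Fin n → ℝ), IsFace M F → polyDim F = n - 1 → x ∉ F → U ∩ F = ∅ := by
  classical
  obtain ⟨U, V, hxU, ⟨U₀, hU₀, hU⟩, ⟨V₀, hV₀, hV⟩, φ, ψ, hbij, hinv, hφ, hψ⟩ := hcl x hx
  set Z : Finset (Fin n) := Finset.univ.filter fun l => φ x l = 0 with hZdef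
  have hZ : ∀ l, l ∈ Z ↔ φ x l = 0 := by intro l; simp [hZdef]
  rw [index_eq hM hMint hxU hU₀ hU hV₀ hV hbij hinv hφ hψ Z hZ]
  obtain ⟨e, he⟩ := exists_perm Z
  obtain ⟨ε, hε, hcon⟩ := polytope_conical hM hx
  have hyV : φ x ∈ V := hbij.mapsTo hxU
  have hψx : ψ (φ x) = x := hinv.1 hxU
  have hψmaps : Set.MapsTo ψ V U := hbij.symm hinv.symm |>.mapsTo
  have hyV' := hyV
  rw [hV] at hyV'
  have hpos : ∀ l, 0 ≤ φ x l := hyV'.1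
  obtain ⟨r, hr, hrV, hrε, hrZ⟩ : ∃ r : ℝ, 0 < r ∧ Metric.ball (φ x) r ⊆ V₀ ∧
      (∀ z ∈ V, dist z (φ x) < r → dist (ψ z) x < ε) ∧ ∀ l, l ∉ Z → r ≤ φ x l := by
    obtain ⟨r₁, hr₁, h₁⟩ := Metric.isOpen_iff.1 hV₀ _ hyV'.2
    obtain ⟨r₂, hr₂, h₂⟩ := Metric.continuousWithinAt_iff.1 (hψ.continuousOn _ hyV) ε hε
    rw [hψx] at h₂
    have h₃ : ∃ r₃ : ℝ, 0 < r₃ ∧ ∀ l, l ∉ Z → r₃ ≤ φ x l := by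
      by_cases hne : (Finset.univ.filter fun l => l ∉ Z).Nonempty
      · obtain ⟨l₀, hl₀, hmin⟩ := Finset.exists_min_image _ (fun l => φ x l) hne
        refine ⟨φ x l₀, ?_, fun l hl => hmin l (by simpa using hl)⟩
        have : l₀ ∉ Z := by simpa using hl₀
        exact lt_of_le_of_ne (hpos l₀) (fun h => this ((hZ l₀).2 h.symm))
      · refine ⟨1, one_pos, fun l hl => ?_⟩
        exact absurd ⟨l, by simpa using hl⟩ hne
    obtain ⟨r₃, hr₃, h₃⟩ := h₃
    refine ⟨min r₁ (min r₂ r₃), by positivity, ?_, ?_, ?_⟩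
    · exact (Metric.ball_subset_ball (min_le_left _ _)).trans h₁
    · intro z hz hd
      exact h₂ hz (lt_of_lt_of_le hd ((min_le_right _ _).trans (min_le_left _ _)))
    · intro l hl
      exact ((min_le_right _ _).trans (min_le_right _ _)).trans (h₃ l hl)
  let α : (Fin n → ℝ) → (Fin n → ℝ) := fun z l => r⁻¹ * (z (e l) - φ x (e l))
  let β : (Fin n → ℝ) → (Fin n → ℝ) := fun t l => φ x l + r * t (e.symm l)
  have hαβ : ∀ t, α (β t) = t := by
    intro t; funext l
    simp only [α, β, Equiv.symm_apply_apply]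
    field_simp; ring
  have hβα : ∀ z, β (α z) = z := by
    intro z; funext l
    simp only [α, β, Equiv.apply_symm_apply]
    field_simp; ring
  have hα : ContDiff ℝ (⊤ : ℕ∞) α := by
    rw [contDiff_pi]; intro l
    exact contDiff_const.mul ((contDiff_apply ℝ ℝ (e l)).sub contDiff_const)
  have hβ : ContDiff ℝ (⊤ : ℕ∞) β := by
    rw [contDiff_pi]; intro l
    exact contDiff_const.add (contDiff_const.mul (contDiff_apply ℝ ℝ (e.symm l)))
  have hβT : ∀ t ∈ Tset n Z.card, β t ∈ V ∧ dist (β t) (φ x) < r := by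
    intro t ht
    have hd : dist (β t) (φ x) < r := by
      rw [dist_pi_lt_iff hr]
      intro l
      have h1 : |t (e.symm l)| < 1 := by
        rcases lt_or_ge ((e.symm l : Fin n) : ℕ) Z.card with h | h
        · have := (ht (e.symm l)).1 h
          rw [abs_lt]; exact ⟨by linarith [this.1], this.2⟩
        · have := (ht (e.symm l)).2 h
          rw [abs_lt]; exact this
      rw [Real.dist_eq]
      simp only [β, add_sub_cancel_left, abs_mul, abs_of_pos hr]
      nlinarith
    refine ⟨?_, hd⟩
    rw [hV]
    refine ⟨fun l => ?_, hrV hd⟩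
    by_cases hl : l ∈ Z
    · have h1 : ((e.symm l : Fin n) : ℕ) < Z.card := by rw [he]; simpa using hl
      have h2 := ((ht (e.symm l)).1 h1).1
      have := hpos l
      simp only [β]
      positivity
    · have h1 := (dist_pi_lt_iff hr).1 hd l
      rw [Real.dist_eq, abs_lt] at h1
      linarith [hrZ l hl]
  have hαT : ∀ z ∈ V, dist z (φ x) < r → α z ∈ Tset n Z.card := by
    intro z hz hd l
    have h1 := (dist_pi_lt_iff hr).1 hd (e l)
    rw [Real.dist_eq, abs_lt] at h1
    have h2 : α z l < 1 := by
      simp only [α]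
      rw [inv_mul_lt_iff₀ hr]; linarith
    refine ⟨fun hl => ⟨?_, h2⟩, fun _ => ⟨?_, h2⟩⟩
    · rw [he, hZ] at hl
      rw [hV] at hz
      have := hz.1 (e l)
      simp only [α, hl, sub_zero]
      positivity
    · simp only [α]
      rw [lt_inv_mul_iff₀ hr]; linarith
  have hopen : ∃ O, IsOpen O ∧ U ∩ φ ⁻¹' Metric.ball (φ x) r = U ∩ O := by
    obtain ⟨O, hO, h⟩ := (continuousOn_iff'.1 hφ.continuousOn) _
      (Metric.isOpen_ball (x := φ x) (ε := r))
    exact ⟨O, hO, by rw [Set.inter_comm, h, Set.inter_comm]⟩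
  obtain ⟨O, hO, hUO⟩ := hopen
  have hInv : Set.InvOn (fun t => ψ (β t)) (fun p => α (φ p))
      (U ∩ φ ⁻¹' Metric.ball (φ x) r) (Tset n Z.card) := by
    constructor
    · intro p hp
      simp only [hβα]
      exact hinv.1 hp.1
    · intro t ht
      simp only
      rw [hinv.2 (hβT t ht).1, hαβ]
  refine ⟨U ∩ φ ⁻¹' Metric.ball (φ x) r, fun p => α (φ p), fun t => ψ (β t),
    ⟨hxU, by simpa using hr⟩, ⟨U₀ ∩ O, hU₀.inter hO, ?_⟩, ?_, hInv, ?_, ?_, ?_, ?_⟩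
  · rw [hUO, hU, Set.inter_assoc]
  · refine hInv.bijOn ?_ ?_
    · intro p hp
      exact hαT _ (hbij.mapsTo hp.1) hp.2
    · intro t ht
      obtain ⟨h1, h2⟩ := hβT t ht
      refine ⟨hψmaps h1, ?_⟩
      change φ (ψ (β t)) ∈ Metric.ball (φ x) r
      rw [hinv.2 h1]; exact h2
  · exact hα.comp_contDiffOn (hφ.mono Set.inter_subset_left)
  · exact hψ.comp hβ.contDiffOn (fun t ht => (hβT t ht).1)
  · funext l; simp [α]
  · intro F hF _ hxF
    rw [Set.eq_empty_iff_forall_notMem]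
    rintro p ⟨⟨hpU, hpr⟩, hpF⟩
    have hpM : p ∈ M := hF.2.subset hpF
    apply hxF
    have hd := hrε _ (hbij.mapsTo hpU) hpr
    rw [hinv.1 hpU, dist_eq_norm] at hd
    -- extend the segment from `x` through `p` a little further
    set c : ℝ := 1 + (ε - ‖p - x‖) / (2 * (‖p - x‖ + 1)) with hc
    have hn := norm_nonneg (p - x)
    have hc1 : 1 < c := by
      rw [hc]
      have : 0 < (ε - ‖p - x‖) / (2 * (‖p - x‖ + 1)) :=
        div_pos (by linarith) (by positivity)
      linarith
    have hc2 : ‖c • (p - x)‖ < ε := by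
      rw [norm_smul, Real.norm_of_nonneg (by linarith), hc, add_mul, one_mul,
        div_mul_eq_mul_div, ← lt_sub_iff_add_lt', div_lt_iff₀ (by positivity)]
      nlinarith
    have hq : x + c • (p - x) ∈ M := by
      refine hcon _ c⁻¹ (by positivity) ?_ hc2
      rw [smul_smul, inv_mul_cancel₀ (by positivity), one_smul]
      simpa using hpM
    refine hF.2.left_mem_of_mem_openSegment hx hq hpF
      ⟨1 - c⁻¹, c⁻¹, ?_, by positivity, by ring, ?_⟩
    · have := inv_lt_one_of_one_lt₀ hc1
      linarith
    · have : c ≠ 0 := by positivity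
      match_scalars <;> field_simp <;> ring
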